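/- Fix integers n ≥ 1 and k ≥ 0, and suppose κ : ℕ × ℕ → ℕ is a function with the following property: for every m ≥ 1 and j ≥ 0, every smooth hypersurface {x ∈ ℝ^m_> : g(x) = 0}, where g is a real polynomial in m variables with at most m+j+1 monomials whose exponent vectors affinely span ℝ^m, has at most κ(m, j) compact connected components. Then every smooth hypersurface {x ∈ ℝ^n_> : f(x) = 0}, where f is a real polynomial in n variables with exactly n+k+1 monomials whose exponent vectors affinely span ℝ^n, has at most Σ_{i=0}^{n−1} binomial(n+1, i) · κ(n−i, k+1) connected components. -/

import Mathlib

/-- The positive zero set in the positive orthant of a real polynomial in `m` variables. -/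
def posZeroSet {m : ℕ} (g : MvPolynomial (Fin m) ℝ) : Set (Fin m → ℝ) :=
  {x | (∀ i, 0 < x i) ∧ MvPolynomial.eval x g = 0}

/-- The set of connected components of a subset `X` of `ℝ^m`, as subsets of `ℝ^m`. -/
def components {m : ℕ} (X : Set (Fin m → ℝ)) : Set (Set (Fin m → ℝ)) :=
  {C | ∃ x ∈ X, C = connectedComponentIn X x}

/-- If the exponents of `g` lie in a proper affine subspace, its positive zero set is invariant
under a one-parameter group of dilations, so none of its components is compact. -/
theorem not_isCompact_of_affineSpan_ne_top {m : ℕ} (hm : 1 ≤ m) {g : MvPolynomial (Fin m) ℝ}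
    (hg : affineSpan ℝ ((fun (a : Fin m →₀ ℕ) (i : Fin m) => (a i : ℝ)) '' ↑g.support) ≠ ⊤)
    {C : Set (Fin m → ℝ)} (hC : C ∈ components (posZeroSet g)) : ¬ IsCompact C := by
  intro hcomp
  obtain ⟨x, ⟨hx, hx0⟩, rfl⟩ := hC
  have : Nonempty (Fin m) := ⟨⟨0, hm⟩⟩
  rw [Ne, AffineSubspace.affineSpan_eq_top_iff_vectorSpan_eq_top_of_nontrivial] at hg
  obtain ⟨φ, hφ, hker⟩ := Submodule.exists_le_ker_of_lt_top _ (lt_top_iff_ne_top.2 hg)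
  let w : Fin m → ℝ := fun i ↦ φ fun j ↦ if i = j then 1 else 0
  have hw : ∀ y : Fin m → ℝ, φ y = ∑ i, y i * w i := fun y ↦ by
    rw [LinearMap.pi_apply_eq_sum_univ φ y]
    rfl
  obtain ⟨i, hi⟩ : ∃ i, w i ≠ 0 := by
    by_contra! h
    exact hφ (LinearMap.ext fun y ↦ by simp [hw, h])
  obtain ⟨c, hc⟩ : ∃ c, ∀ a ∈ g.support, ∑ i, (a i : ℝ) * w i = c := by
    rcases g.support.eq_empty_or_nonempty with h | ⟨b, hb⟩
    · exact ⟨0, by simp [h]⟩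
    · refine ⟨∑ i, (b i : ℝ) * w i, fun a ha ↦ ?_⟩
      have := hker (vsub_mem_vectorSpan ℝ (Set.mem_image_of_mem _ (Finset.mem_coe.2 ha))
        (Set.mem_image_of_mem _ (Finset.mem_coe.2 hb)))
      rw [LinearMap.mem_ker, vsub_eq_sub, map_sub, sub_eq_zero, hw, hw] at this
      exact this
  let γ : ℝ → Fin m → ℝ := fun s i ↦ Real.exp (s * w i) * x i
  have hγ : Continuous γ := by fun_prop
  have hγ0 : γ 0 = x := by ext; simp [γ]
  have hmem : ∀ s, γ s ∈ posZeroSet g := fun s ↦ by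
    refine ⟨fun i ↦ mul_pos (Real.exp_pos _) (hx i), ?_⟩
    have : MvPolynomial.eval (γ s) g = Real.exp (s * c) * MvPolynomial.eval x g := by
      rw [MvPolynomial.eval_eq', MvPolynomial.eval_eq', Finset.mul_sum]
      refine Finset.sum_congr rfl fun a ha ↦ ?_
      simp only [γ, mul_pow, Finset.prod_mul_distrib, ← Real.exp_nat_mul, ← Real.exp_sum]
      rw [← hc a ha, Finset.mul_sum]
      have : ∀ i, (a i : ℝ) * (s * w i) = s * (a i * w i) := fun i ↦ by ring
      simp only [this]
      ring
    rw [this, hx0, mul_zero]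
  have hsub : Set.range γ ⊆ connectedComponentIn (posZeroSet g) x :=
    (isPreconnected_range hγ).subset_connectedComponentIn ⟨0, hγ0⟩ (Set.range_subset_iff.2 hmem)
  obtain ⟨M, hM⟩ := (hcomp.image (continuous_apply i)).bddAbove
  have h1 := hM ⟨γ (Real.log ((|M| + 1) / x i) / w i), hsub ⟨_, rfl⟩, rfl⟩
  simp only [γ] at h1
  rw [div_mul_cancel₀ _ hi, Real.exp_log (div_pos (by positivity) (hx i)),
    div_mul_cancel₀ _ (hx i).ne'] at h1
  linarith [le_abs_self M]
open scoped IntermediateField.algebraAdjoinAdjoin in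
/-- An element transcendental over a field of characteristic zero is moved by some derivation. -/
theorem exists_derivation_ne_zero {K L : Type*} [Field K] [Field L] [Algebra K L] [CharZero K]
    {v : L} (hv : Transcendental K v) : ∃ D : Derivation K L L, D v ≠ 0 := by
  classical
  obtain ⟨s, hs, hb⟩ := exists_isTranscendenceBasis_superset (R := K) (s := {v})
    ((algebraicIndependent_singleton_iff (⟨v, rfl⟩ : ({v} : Set L))).2 hv)
  let w : s := ⟨v, hs rfl⟩
  let S := Algebra.adjoin K (Set.range ((↑) : s → L))
  let E := IntermediateField.adjoin K (Set.range ((↑) : s → L))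
  let e : MvPolynomial s K ≃ₐ[K] S := hb.1.aevalEquiv
  have hS : Algebra.FormallyEtale S E := .of_isLocalization (nonZeroDivisors _)
  have hE : Algebra.IsAlgebraic E L := hb.isAlgebraic_field
  have : Algebra.FormallyEtale E L := .of_isSeparable _ L
  have : Algebra.FormallyEtale S L := .comp S E L
  let d : Derivation K (MvPolynomial s K) (MvPolynomial s K) := MvPolynomial.pderiv w
  let dS : Derivation K S L := Derivation.mk'
    (S.val.toLinearMap ∘ₗ e.toLinearMap ∘ₗ d.toLinearMap ∘ₗ e.symm.toLinearMap) (by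
      intro a b
      simp [Algebra.smul_def])
  let D : Derivation K L L := ((LinearMap.liftBaseChange L dS.liftKaehlerDifferential) ∘ₗ
    (KaehlerDifferential.tensorKaehlerEquivOfFormallyEtale K S L).symm.toLinearMap).compDer
      (KaehlerDifferential.D K L)
  have hew : algebraMap S L (e (MvPolynomial.X w)) = v := by
    exact (hb.1.algebraMap_aevalEquiv (MvPolynomial.X w)).trans (MvPolynomial.aeval_X _ _)
  refine ⟨D, ?_⟩
  have h2 : D v = dS (e (MvPolynomial.X w)) := by
    have h3 := KaehlerDifferential.tensorKaehlerEquivOfFormallyEtale_symm_D_algebraMap K S L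
      (e (MvPolynomial.X w))
    rw [hew] at h3
    change LinearMap.liftBaseChange L dS.liftKaehlerDifferential
      ((KaehlerDifferential.tensorKaehlerEquivOfFormallyEtale K S L).symm
        (KaehlerDifferential.D K L v)) = _
    rw [h3, LinearMap.liftBaseChange_tmul, one_smul, Derivation.liftKaehlerDifferential_comp_D]
  rw [h2]
  simp [dS, d]

/-- Arbitrarily small positive parameters, any one of which can be moved by a derivation of `ℝ`
that kills the others and a given countable set. -/
theorem exists_small_independent {S : Set ℝ} (hS : S.Countable) {δ : ℝ} (hδ : 0 < δ) (n : ℕ) :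
    ∃ ε : Fin n → ℝ, (∀ j, 0 < ε j ∧ ε j < δ) ∧ ∀ j, ∃ D : Derivation ℤ ℝ ℝ,
      (∀ c ∈ S, D c = 0) ∧ D (ε j) ≠ 0 ∧ ∀ i, i ≠ j → D (ε i) = 0 := by
  induction n with
  | zero => exact ⟨Fin.elim0, fun j ↦ j.elim0, fun j ↦ j.elim0⟩
  | succ n ih =>
    obtain ⟨ε, hε, hD⟩ := ih
    let T := S ∪ Set.range ε
    let K := Subfield.closure T
    have hT : T.Countable := hS.union (Set.countable_range ε)
    have : Countable K := by
      rw [← Cardinal.mk_le_aleph0_iff]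
      exact (Subfield.cardinalMk_closure_le_max T).trans
        (max_le (Cardinal.mk_le_aleph0_iff.2 hT.to_subtype) le_rfl)
    obtain ⟨v, hv, hvt⟩ : ∃ v ∈ Set.Ioo 0 δ, v ∉ {x : ℝ | IsAlgebraic K x} := by
      by_contra! h
      exact (mt Cardinal.Real.Ioo_countable_iff.1 (not_le.2 hδ))
        ((Algebraic.countable K ℝ).mono h)
    obtain ⟨E, hE⟩ := exists_derivation_ne_zero (K := K) (v := v) hvt
    have hET : ∀ c ∈ T, E c = 0 := fun c hc ↦
      E.map_algebraMap (⟨c, Subfield.subset_closure hc⟩ : K)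
    let E' : Derivation ℤ ℝ ℝ := E.restrictScalars ℤ
    have hE' : ∀ x, E' x = E x := fun _ ↦ rfl
    refine ⟨Fin.snoc ε v, fun j ↦ ?_, fun j ↦ ?_⟩
    · refine Fin.lastCases ?_ (fun j ↦ ?_) j
      · simpa using hv
      · simpa using hε j
    · refine Fin.lastCases ?_ (fun j ↦ ?_) j
      · refine ⟨E', fun c hc ↦ hET c (Or.inl hc), by simpa [hE'] using hE, fun i ↦ ?_⟩
        refine Fin.lastCases (by simp) (fun i _ ↦ ?_) i
        simpa [hE'] using hET _ (Or.inr ⟨i, rfl⟩)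
      · obtain ⟨D, h1, h2, h3⟩ := hD j
        refine ⟨D - (D v / E v) • E', fun c hc ↦ ?_, ?_, fun i ↦ ?_⟩
        · simp [h1 c hc, hE', hET c (Or.inl hc)]
        · simpa [hE', hET _ (Or.inr ⟨j, rfl⟩)] using h2
        · refine Fin.lastCases (fun _ ↦ ?_) (fun i hi ↦ ?_) i
          · simp [hE', hE]
          · have : i ≠ j := fun h ↦ hi (by rw [h])
            simp [hE', hET _ (Or.inr ⟨i, rfl⟩), h3 i this]
/-- The value at `u` of the Laurent polynomial with exponents `e a` and coefficients `c a`. -/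
noncomputable def laurentEval {α ι : Type*} [Fintype ι] (s : Finset α) (c : α → ℝ)
    (e : α → ι → ℤ) (u : ι → ℝ) : ℝ :=
  ∑ a ∈ s, c a * ∏ j, u j ^ e a j

/-- The value at `u` of the `j`-th logarithmic derivative of a Laurent polynomial. -/
noncomputable def laurentLogDeriv {α ι : Type*} [Fintype ι] (s : Finset α) (c : α → ℝ)
    (e : α → ι → ℤ) (j : ι) (u : ι → ℝ) : ℝ :=
  laurentEval s (fun a ↦ c a * e a j) e u

theorem Derivation.map_prod_eq_mul_sum_div {ι : Type*} (D : Derivation ℤ ℝ ℝ) (T : Finset ι)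
    {v : ι → ℝ} (hv : ∀ j, v j ≠ 0) :
    D (∏ j ∈ T, v j) = (∏ j ∈ T, v j) * ∑ j ∈ T, D (v j) / v j := by
  classical
  induction T using Finset.induction_on with
  | empty => simp
  | insert a T ha ih =>
    rw [Finset.prod_insert ha, Finset.sum_insert ha, D.leibniz, ih, smul_eq_mul, smul_eq_mul]
    field_simp [hv a]
    ring

theorem Derivation.map_laurentEval {α ι : Type*} [Fintype ι] (D : Derivation ℤ ℝ ℝ)
    {s : Finset α} {c : α → ℝ} (hc : ∀ a ∈ s, D (c a) = 0) (e : α → ι → ℤ) {u : ι → ℝ}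
    (hu : ∀ j, 0 < u j) :
    D (laurentEval s c e u) = ∑ j, laurentLogDeriv s c e j u * (D (u j) / u j) := by
  have hu' := fun j ↦ (hu j).ne'
  simp only [laurentLogDeriv, laurentEval, map_sum, Finset.sum_mul]
  rw [Finset.sum_comm]
  refine Finset.sum_congr rfl fun a ha ↦ ?_
  rw [D.leibniz, hc a ha, smul_zero, add_zero,
    D.map_prod_eq_mul_sum_div _ fun j ↦ zpow_ne_zero _ (hu' j), smul_eq_mul, Finset.mul_sum,
    Finset.mul_sum]
  refine Finset.sum_congr rfl fun j _ ↦ ?_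
  rw [D.leibniz_zpow, zsmul_eq_mul, smul_eq_mul, zpow_sub_one₀ (hu' j)]
  field_simp [hu' j, zpow_ne_zero (e a j) (hu' j)]

/-- Algebraic form of Sard's theorem: on a face cut out by generic parameters, a critical zero of
a Laurent polynomial restricted to the face is a critical zero on the whole torus. -/
theorem laurentLogDeriv_eq_of_generic {α ι : Type*} [Fintype ι] {s : Finset α} {c : α → ℝ}
    {e : α → ι → ℤ} {ε : ι → ℝ}
    (hε : ∀ j, ∃ D : Derivation ℤ ℝ ℝ, (∀ a ∈ s, D (c a) = 0) ∧ D (ε j) ≠ 0 ∧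
      ∀ i, i ≠ j → D (ε i) = 0)
    {J : Finset ι} {u : ι → ℝ} (hu : ∀ j, 0 < u j) (hprod : ∏ j, u j = 1)
    (hJ : ∀ j ∈ J, u j = ε j) (h0 : laurentEval s c e u = 0) {r : ℝ}
    (hr : ∀ i ∉ J, laurentLogDeriv s c e i u = r) (j : ι) : laurentLogDeriv s c e j u = r := by
  by_cases hj : j ∈ J
  swap
  · exact hr j hj
  obtain ⟨D, hc, hj0, hji⟩ := hε j
  have h1 := D.map_laurentEval hc e hu
  have h2 := D.map_prod_eq_mul_sum_div Finset.univ fun j ↦ (hu j).ne'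
  rw [hprod, D.map_one_eq_zero, one_mul] at h2
  rw [h0, map_zero] at h1
  have h3 : ∑ i, (laurentLogDeriv s c e i u - r) * (D (u i) / u i) = 0 := by
    simp only [sub_mul, Finset.sum_sub_distrib, ← Finset.mul_sum, ← h1, ← h2, mul_zero, sub_zero]
  rw [Finset.sum_eq_single j] at h3
  · rw [hJ j hj] at h3
    have : ε j ≠ 0 := hJ j hj ▸ (hu j).ne'
    exact sub_eq_zero.1 ((mul_eq_zero.1 h3).resolve_right (div_ne_zero hj0 this))
  · intro i _ hij
    by_cases hi : i ∈ J
    · simp [hJ i hi, hji i hij]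
    · simp [hr i hi]
  · simp

section Face

variable {ι : Type*} [DecidableEq ι] {m : ℕ} {J : Finset ι} {l : ι}

theorem prod_eq_prod_face_mul [Fintype ι] {M : Type*} [CommMonoid M] (hl : l ∉ J)
    (τ : Fin m ≃ {j // j ∉ J ∧ j ≠ l}) (G : ι → M) :
    ∏ j, G j = (∏ j ∈ J, G j) * (G l * ∏ q, G (τ q)) := by
  rw [← Finset.prod_mul_prod_compl J, ← Finset.mul_prod_erase Jᶜ G (Finset.mem_compl.2 hl),
    Equiv.prod_comp τ (fun j ↦ G j)]
  congr 2
  exact Finset.prod_subtype _ (fun j ↦ by simp [and_comm]) G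

/-- The parametrization of the face `{u | ∏ j, u j = 1, ∀ j ∈ J, u j = ε j}` of the torus by the
coordinates outside `J` other than the `l`-th one. -/
noncomputable def facePoint (J : Finset ι) (l : ι) (τ : Fin m ≃ {j // j ∉ J ∧ j ≠ l}) (ε : ι → ℝ)
    (t : Fin m → ℝ) (j : ι) : ℝ :=
  if h : j ∉ J ∧ j ≠ l then t (τ.symm ⟨j, h⟩) else
    if j ∈ J then ε j else ((∏ i ∈ J, ε i) * ∏ q, t q)⁻¹

variable {τ : Fin m ≃ {j // j ∉ J ∧ j ≠ l}} {ε : ι → ℝ} {t : Fin m → ℝ}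

theorem facePoint_of_mem {j : ι} (hj : j ∈ J) : facePoint J l τ ε t j = ε j := by
  simp [facePoint, hj]

theorem facePoint_equiv (q : Fin m) : facePoint J l τ ε t (τ q) = t q := by
  simp [facePoint, (τ q).2]

theorem facePoint_self (hl : l ∉ J) :
    facePoint J l τ ε t l = ((∏ i ∈ J, ε i) * ∏ q, t q)⁻¹ := by
  simp [facePoint, hl]

theorem facePoint_pos (hε : ∀ j, 0 < ε j) (ht : ∀ q, 0 < t q) (j : ι) :
    0 < facePoint J l τ ε t j := by
  unfold facePoint
  split_ifs
  · exact ht _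
  · exact hε _
  · exact inv_pos.2 (mul_pos (Finset.prod_pos fun i _ ↦ hε i) (Finset.prod_pos fun q _ ↦ ht q))

theorem prod_facePoint [Fintype ι] (hl : l ∉ J) (hε : ∀ j, 0 < ε j) (ht : ∀ q, 0 < t q) :
    ∏ j, facePoint J l τ ε t j = 1 := by
  rw [prod_eq_prod_face_mul hl τ, facePoint_self hl, Finset.prod_congr rfl fun j hj ↦
    facePoint_of_mem hj, Finset.prod_congr rfl fun q _ ↦ facePoint_equiv q]
  have h1 : (0 : ℝ) < ∏ i ∈ J, ε i := Finset.prod_pos fun i _ ↦ hε i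
  have h2 : (0 : ℝ) < ∏ q, t q := Finset.prod_pos fun q _ ↦ ht q
  field_simp

theorem facePoint_eq_of_prod_eq_one [Fintype ι] (hl : l ∉ J) {u : ι → ℝ}
    (hprod : ∏ j, u j = 1) (hJ : ∀ j ∈ J, u j = ε j) :
    facePoint J l τ ε (fun q ↦ u (τ q)) = u := by
  ext j
  by_cases hj : j ∈ J
  · rw [facePoint_of_mem hj, hJ j hj]
  by_cases hjl : j = l
  · subst hjl
    rw [facePoint_self hl]
    rw [prod_eq_prod_face_mul hl τ, Finset.prod_congr rfl hJ] at hprod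
    refine inv_eq_of_mul_eq_one_left ?_
    rw [← hprod]
    ring
  · simp [facePoint, hj, hjl]

theorem continuousOn_facePoint (hε : ∀ j, 0 < ε j) :
    ContinuousOn (facePoint J l τ ε) {t | ∀ q, 0 < t q} := by
  refine continuousOn_pi.2 fun j ↦ ?_
  unfold facePoint
  split_ifs
  · fun_prop
  · fun_prop
  · refine ContinuousOn.inv₀ (by fun_prop) fun t ht ↦ ?_
    exact (mul_pos (Finset.prod_pos fun i _ ↦ hε i) (Finset.prod_pos fun q _ ↦ ht q)).ne'

theorem isOpen_facePoint_gt [Fintype ι] (hε : ∀ j, 0 < ε j) :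
    IsOpen {t | (∀ q, 0 < t q) ∧ ∀ j ∉ J, ε j < facePoint J l τ ε t j} := by
  have h1 : IsOpen {t : Fin m → ℝ | ∀ q, 0 < t q} := by
    simp only [Set.ofPred_forall]
    exact isOpen_iInter_of_finite fun q ↦ isOpen_lt continuous_const (continuous_apply q)
  have h2 : IsOpen {u : ι → ℝ | ∀ j ∉ J, ε j < u j} := by
    simp only [Set.ofPred_forall]
    exact isOpen_iInter_of_finite fun j ↦ isOpen_iInter_of_finite fun _ ↦
      isOpen_lt continuous_const (continuous_apply j)
  exact (continuousOn_facePoint hε).isOpen_inter_preimage h1 h2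

theorem isCompact_facePoint_ge (hl : l ∉ J) (hε : ∀ j, 0 < ε j) :
    IsCompact {t | (∀ q, 0 < t q) ∧ ∀ j, ε j ≤ facePoint J l τ ε t j} := by
  have hE : 0 < ∏ i ∈ J, ε i := Finset.prod_pos fun i _ ↦ hε i
  have key : {t | (∀ q, 0 < t q) ∧ ∀ j, ε j ≤ facePoint J l τ ε t j} =
      {t | (∀ q, ε (τ q) ≤ t q) ∧ ε l * ((∏ i ∈ J, ε i) * ∏ q, t q) ≤ 1} := by
    ext t
    simp only [Set.mem_ofPred_eq]
    constructor
    · rintro ⟨h1, h2⟩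
      refine ⟨fun q ↦ by simpa [facePoint_equiv] using h2 (τ q), ?_⟩
      have h3 := h2 l
      rwa [facePoint_self hl, le_inv_comm₀ (hε l), ← one_div, le_div_iff₀' (hε l)] at h3
      exact mul_pos hE (Finset.prod_pos fun q _ ↦ h1 q)
    · rintro ⟨h1, h2⟩
      have h3 : ∀ q, 0 < t q := fun q ↦ (hε _).trans_le (h1 q)
      refine ⟨h3, fun j ↦ ?_⟩
      by_cases hj : j ∈ J
      · rw [facePoint_of_mem hj]
      by_cases hjl : j = l
      · subst hjl
        rwa [facePoint_self hl, le_inv_comm₀ (hε j), ← one_div, le_div_iff₀' (hε j)]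
        exact mul_pos hE (Finset.prod_pos fun q _ ↦ h3 q)
      · have := h1 (τ.symm ⟨j, hj, hjl⟩)
        simpa [facePoint, hj, hjl] using this
  rw [key]
  have hclosed : IsClosed {t : Fin m → ℝ | (∀ q, ε (τ q) ≤ t q) ∧
      ε l * ((∏ i ∈ J, ε i) * ∏ q, t q) ≤ 1} := by
    refine IsClosed.inter ?_ (isClosed_le (f := fun t : Fin m → ℝ ↦ ε l * ((∏ i ∈ J, ε i) * ∏ q, t q))
      (by fun_prop) continuous_const)
    change IsClosed {t : Fin m → ℝ | ∀ q, ε (τ q) ≤ t q}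
    simp only [Set.ofPred_forall]
    exact isClosed_iInter fun q ↦ isClosed_le continuous_const (continuous_apply q)
  let b : Fin m → ℝ := fun q ↦
    (ε l * ((∏ i ∈ J, ε i) * ∏ r ∈ Finset.univ.erase q, ε (τ r)))⁻¹
  refine (isCompact_Icc (a := fun q ↦ ε (τ q)) (b := b)).of_isClosed_subset hclosed ?_
  rintro t ⟨h1, h2⟩
  refine ⟨h1, fun q ↦ ?_⟩
  have hpos : 0 < ε l * ((∏ i ∈ J, ε i) * ∏ r ∈ Finset.univ.erase q, ε (τ r)) :=
    mul_pos (hε l) (mul_pos hE (Finset.prod_pos fun r _ ↦ hε _))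
  have ht : 0 < t q := (hε _).trans_le (h1 q)
  change t q ≤ _⁻¹
  rw [← one_div, le_div_iff₀ hpos]
  refine le_trans ?_ h2
  rw [← Finset.mul_prod_erase _ t (Finset.mem_univ q), mul_left_comm, mul_left_comm (t q)]
  gcongr with r _
  · exact (hε l).le
  · exact fun r _ ↦ (hε _).le
  · exact h1 _

theorem prod_facePoint_zpow [Fintype ι] (hl : l ∉ J) (ht : ∀ q, 0 < t q) (e : ι → ℤ) :
    ∏ j, facePoint J l τ ε t j ^ e j =
      ((∏ j ∈ J, ε j ^ e j) * (∏ j ∈ J, ε j) ^ (-e l)) * ∏ q, t q ^ (e (τ q) - e l) := by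
  have h1 : ∀ j ∈ J, facePoint J l τ ε t j ^ e j = ε j ^ e j := fun j hj ↦ by
    rw [facePoint_of_mem hj]
  rw [prod_eq_prod_face_mul hl τ, facePoint_self hl, Finset.prod_congr rfl h1]
  simp only [facePoint_equiv, fun q ↦ zpow_sub₀ (ht q).ne', Finset.prod_div_distrib,
    Finset.prod_zpow, inv_zpow, mul_zpow, zpow_neg, mul_inv]
  ring

end Face

section FacePolynomial

variable {α ι : Type*} {m : ℕ} {J : Finset ι} {l : ι}

/-- The restriction of a Laurent polynomial to a face, made polynomial by clearing denominators. -/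
noncomputable def facePolynomial (s : Finset α) (c : α → ℝ) (e : α → ι → ℤ) (l : ι)
    (τ : Fin m ≃ {j // j ∉ J ∧ j ≠ l}) (ε : ι → ℝ) (d : ℕ) : MvPolynomial (Fin m) ℝ :=
  ∑ a ∈ s, MvPolynomial.monomial
    (Finsupp.equivFunOnFinite.symm fun q ↦ (d + e a (τ q) - e a l).toNat)
    (c a * ((∏ j ∈ J, ε j ^ e a j) * (∏ j ∈ J, ε j) ^ (-e a l)))

variable {τ : Fin m ≃ {j // j ∉ J ∧ j ≠ l}} {ε : ι → ℝ} {t : Fin m → ℝ}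
  {s : Finset α} {c : α → ℝ} {e : α → ι → ℤ} {d : ℕ}

theorem eval_facePolynomial [Fintype ι] [DecidableEq ι] (hl : l ∉ J)
    (hd : ∀ a ∈ s, ∀ q, 0 ≤ d + e a (τ q) - e a l) (ht : ∀ q, 0 < t q) :
    MvPolynomial.eval t (facePolynomial s c e l τ ε d) =
      (∏ q, t q) ^ d * laurentEval s c e (facePoint J l τ ε t) := by
  rw [facePolynomial, laurentEval, map_sum, Finset.mul_sum]
  refine Finset.sum_congr rfl fun a ha ↦ ?_
  rw [MvPolynomial.eval_monomial, prod_facePoint_zpow hl ht, Finsupp.prod_fintype _ _ (by simp),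
    ← Finset.prod_pow]
  have : ∀ q, t q ^ (d + e a (τ q) - e a l).toNat = t q ^ d * t q ^ (e a (τ q) - e a l) :=
    fun q ↦ by
      rw [← zpow_natCast, Int.toNat_of_nonneg (hd a ha q), add_sub_assoc,
        zpow_add₀ (ht q).ne', zpow_natCast]
  simp only [Finsupp.equivFunOnFinite_symm_apply_apply, this, Finset.prod_mul_distrib]
  ring

theorem mul_eval_pderiv_facePolynomial [Fintype ι] [DecidableEq ι] (hl : l ∉ J)
    (hd : ∀ a ∈ s, ∀ q, 0 ≤ d + e a (τ q) - e a l) (ht : ∀ q, 0 < t q) (q : Fin m) :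
    t q * MvPolynomial.eval t (MvPolynomial.pderiv q (facePolynomial s c e l τ ε d)) =
      (∏ q, t q) ^ d * (d * laurentEval s c e (facePoint J l τ ε t) +
        laurentLogDeriv s c e (τ q) (facePoint J l τ ε t) -
        laurentLogDeriv s c e l (facePoint J l τ ε t)) := by
  have h1 : t q * MvPolynomial.eval t (MvPolynomial.pderiv q (facePolynomial s c e l τ ε d)) =
      MvPolynomial.eval t (facePolynomial s (fun a ↦ c a * (d + e a (τ q) - e a l)) e l τ ε d) := by
    conv_lhs => enter [1]; rw [← MvPolynomial.eval_X (f := t) q]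
    rw [← map_mul, facePolynomial, map_sum, Finset.mul_sum, facePolynomial]
    congr 1
    refine Finset.sum_congr rfl fun a ha ↦ ?_
    rw [MvPolynomial.X_mul_pderiv_monomial, MvPolynomial.smul_monomial]
    congr 1
    have : (((d + e a (τ q) - e a l).toNat : ℤ) : ℝ) = d + e a (τ q) - e a l := by
      rw [Int.toNat_of_nonneg (hd a ha q)]
      push_cast
      ring
    rw [Int.cast_natCast] at this
    simp only [Finsupp.equivFunOnFinite_symm_apply_apply, nsmul_eq_mul, this]
    ring
  rw [h1, eval_facePolynomial hl hd ht]
  congr 1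
  simp only [laurentLogDeriv, laurentEval, Finset.mul_sum, ← Finset.sum_add_distrib,
    ← Finset.sum_sub_distrib]
  refine Finset.sum_congr rfl fun a _ ↦ ?_
  ring

theorem card_support_facePolynomial_le {T : Finset α} (hTs : T ⊆ s) (hT : T.Nonempty)
    (hTe : ∀ a ∈ T, ∀ b ∈ T, ∀ j ∉ J, e a j - e a l = e b j - e b l) :
    (facePolynomial s c e l τ ε d).support.card + T.card ≤ s.card + 1 := by
  classical
  obtain ⟨b, hb⟩ := hT
  let E : α → (Fin m →₀ ℕ) := fun a ↦
    Finsupp.equivFunOnFinite.symm fun q ↦ (d + e a (τ q) - e a l).toNat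
  have hsub : (facePolynomial s c e l τ ε d).support ⊆ insert (E b) ((s \ T).image E) := by
    refine (MvPolynomial.support_sum).trans fun x hx ↦ ?_
    obtain ⟨a, ha, hxa⟩ := Finset.mem_biUnion.1 hx
    have hxE : x = E a := by
      simpa using MvPolynomial.support_monomial_subset hxa
    subst hxE
    by_cases haT : a ∈ T
    · have : E a = E b := by
        ext q
        have h := hTe a haT b hb (τ q) (τ q).2.1
        simp only [E, Finsupp.equivFunOnFinite_symm_apply_apply, add_sub_assoc, h]
      simp [this]
    · exact Finset.mem_insert_of_mem
        (Finset.mem_image_of_mem _ (Finset.mem_sdiff.2 ⟨ha, haT⟩))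
  have h1 := (Finset.card_le_card hsub).trans (Finset.card_insert_le _ _)
  have h2 : ((s \ T).image E).card ≤ (s \ T).card := Finset.card_image_le
  have h3 := Finset.card_sdiff_add_card_eq_card hTs
  omega

end FacePolynomial

/-- A preconnected set meeting a closed set `A` in a relatively open subset lies in `A`. -/
theorem IsPreconnected.subset_of_inter_open {X : Type*} [TopologicalSpace X] {K A U : Set X}
    (hK : IsPreconnected K) (hA : IsClosed A) (hU : IsOpen U) (hAU : K ∩ A = K ∩ U)
    (hne : (K ∩ A).Nonempty) : K ⊆ A := by
  have h := (isPreconnected_iff_subset_of_disjoint.1 hK) U Aᶜ hU hA.isOpen_compl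
    (fun x hx ↦ by
      by_cases hxA : x ∈ A
      · exact Or.inl (hAU ▸ ⟨hx, hxA⟩ : x ∈ K ∩ U).2
      · exact Or.inr hxA)
    (by
      rw [← Set.inter_assoc, ← hAU, Set.inter_assoc, Set.inter_compl_self, Set.inter_empty])
  rcases h with h | h
  · exact fun x hx ↦ (hAU.symm ▸ ⟨hx, h hx⟩ : x ∈ K ∩ A).2
  · obtain ⟨x, hxK, hxA⟩ := hne
    exact absurd hxA (h hxK)

theorem IsCompact.isCompact_connectedComponentIn {X : Type*} [TopologicalSpace X] [T2Space X]
    {Z A : Set X} {x : X} (hA : IsCompact A) (hAZ : A ⊆ Z)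
    (h : connectedComponentIn Z x ⊆ A) : IsCompact (connectedComponentIn Z x) := by
  by_cases hx : x ∈ Z
  · refine hA.of_isClosed_subset (isClosed_of_closure_subset ?_) h
    exact isPreconnected_connectedComponentIn.closure.subset_connectedComponentIn
      (subset_closure (mem_connectedComponentIn hx))
      ((closure_minimal h hA.isClosed).trans hAZ)
  · rw [connectedComponentIn_eq_empty hx]
    exact isCompact_empty

/-- The affine span hypothesis in a bound on compact components can be dropped. -/
theorem compact_components_le {m : ℕ} (hm : 1 ≤ m) {N B : ℕ}
    (h : ∀ g : MvPolynomial (Fin m) ℝ, g.support.card ≤ N →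
      affineSpan ℝ ((fun (a : Fin m →₀ ℕ) (i : Fin m) => (a i : ℝ)) '' ↑g.support) = ⊤ →
      (∀ x ∈ posZeroSet g, ∃ i, MvPolynomial.eval x (MvPolynomial.pderiv i g) ≠ 0) →
      {C ∈ components (posZeroSet g) | IsCompact C}.Finite ∧
        {C ∈ components (posZeroSet g) | IsCompact C}.ncard ≤ B)
    {g : MvPolynomial (Fin m) ℝ} (hg : g.support.card ≤ N)
    (hsm : ∀ x ∈ posZeroSet g, ∃ i, MvPolynomial.eval x (MvPolynomial.pderiv i g) ≠ 0) :
    {C ∈ components (posZeroSet g) | IsCompact C}.Finite ∧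
      {C ∈ components (posZeroSet g) | IsCompact C}.ncard ≤ B := by
  by_cases hspan :
      affineSpan ℝ ((fun (a : Fin m →₀ ℕ) (i : Fin m) => (a i : ℝ)) '' ↑g.support) = ⊤
  · exact h g hg hspan hsm
  · have : {C ∈ components (posZeroSet g) | IsCompact C} = ∅ :=
      Set.eq_empty_of_forall_notMem fun C hC ↦ not_isCompact_of_affineSpan_ne_top hm hspan hC.1 hC.2
    simp [this]

theorem eq_connectedComponentIn_of_mem_components {n : ℕ} {X C : Set (Fin n → ℝ)}
    (hC : C ∈ components X) {y : Fin n → ℝ} (hy : y ∈ C) : C = connectedComponentIn X y := by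
  obtain ⟨x, _, rfl⟩ := hC
  exact connectedComponentIn_eq hy

theorem exists_equiv_face {n m : ℕ} {J : Finset (Fin (n + 1))} (hJm : J.card + m = n)
    {l : Fin (n + 1)} (hl : l ∉ J) : Nonempty (Fin m ≃ {j // j ∉ J ∧ j ≠ l}) := by
  refine ⟨(Fintype.equivFinOfCardEq ?_).symm⟩
  have h1 : (Jᶜ.erase l).card = m := by
    rw [Finset.card_erase_of_mem (Finset.mem_compl.2 hl), Finset.card_compl, Fintype.card_fin]
    omega
  rw [← h1]
  exact Fintype.card_of_subtype _ fun j ↦ by simp [and_comm]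

theorem exists_nat_add_sub_nonneg {α ι : Type*} [Finite ι] (s : Finset α) (e : α → ι → ℤ) (l : ι) :
    ∃ d : ℕ, ∀ a ∈ s, ∀ j, 0 ≤ d + e a j - e a l := by
  obtain ⟨M, hM⟩ := ((s.finite_toSet.prod (Set.finite_univ (α := ι))).image
    fun x ↦ e x.1 l - e x.1 x.2).bddAbove
  refine ⟨M.toNat, fun a ha j ↦ ?_⟩
  have h1 := hM ⟨(a, j), ⟨ha, Set.mem_univ _⟩, rfl⟩
  have h2 := Int.self_le_toNat M
  simp only at h1
  omega

/-- The components which meet the face `J` of the simplex, and none of its proper faces, are counted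
by the compact components of the face polynomial. -/
theorem card_components_le_of_face {α : Type*} {n k m B : ℕ} (hm : 1 ≤ m)
    (hB : ∀ g : MvPolynomial (Fin m) ℝ, g.support.card ≤ m + (k + 1) + 1 →
      affineSpan ℝ ((fun (a : Fin m →₀ ℕ) (i : Fin m) => (a i : ℝ)) '' ↑g.support) = ⊤ →
      (∀ x ∈ posZeroSet g, ∃ i, MvPolynomial.eval x (MvPolynomial.pderiv i g) ≠ 0) →
      {C ∈ components (posZeroSet g) | IsCompact C}.Finite ∧
        {C ∈ components (posZeroSet g) | IsCompact C}.ncard ≤ B)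
    {s : Finset α} {c : α → ℝ} {e : α → Fin (n + 1) → ℤ} (hcard : s.card = n + k + 1)
    {p : Fin (n + 1) → α} (hp : Function.Injective p) (hps : ∀ j, p j ∈ s)
    (hpe : ∀ j i, i ≠ j → e (p j) i = e (p 0) i)
    (hsm : ∀ u : Fin (n + 1) → ℝ, (∀ j, 0 < u j) → laurentEval s c e u = 0 →
      ∃ i j, laurentLogDeriv s c e i u ≠ laurentLogDeriv s c e j u)
    {ε : Fin (n + 1) → ℝ} (hε0 : ∀ j, 0 < ε j)
    (hε : ∀ j, ∃ D : Derivation ℤ ℝ ℝ, (∀ a ∈ s, D (c a) = 0) ∧ D (ε j) ≠ 0 ∧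
      ∀ i, i ≠ j → D (ε i) = 0)
    {X : Set (Fin n → ℝ)} {Φ : (Fin (n + 1) → ℝ) → Fin n → ℝ}
    (hΦ : ContinuousOn Φ {u | ∀ j, 0 < u j})
    (hΦX : ∀ u, (∀ j, 0 < u j) → laurentEval s c e u = 0 → Φ u ∈ X)
    {J : Finset (Fin (n + 1))} (hJm : J.card + m = n)
    {T : Finset (Set (Fin n → ℝ))} (hT : ∀ C ∈ T, C ∈ components X)
    (hTJ : ∀ C ∈ T, ∃ u : Fin (n + 1) → ℝ, (∀ j, 0 < u j) ∧ ∏ j, u j = 1 ∧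
      laurentEval s c e u = 0 ∧ Φ u ∈ C ∧ (∀ j, ε j ≤ u j) ∧ ∀ j ∈ J, u j = ε j)
    (hmax : ∀ C ∈ T, ∀ u : Fin (n + 1) → ℝ, (∀ j, 0 < u j) → ∏ j, u j = 1 →
      laurentEval s c e u = 0 → Φ u ∈ C → (∀ j, ε j ≤ u j) → (∀ j ∈ J, u j = ε j) →
      ∀ j ∉ J, ε j < u j) :
    T.card ≤ B := by
  classical
  obtain ⟨l, hl⟩ : ∃ l, l ∉ J := by
    by_contra! h
    have := Finset.card_eq_of_equiv_fin (n := n + 1) (s := J)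
      ((Equiv.subtypeUnivEquiv h).trans (Equiv.refl _))
    omega
  obtain ⟨τ⟩ := exists_equiv_face hJm hl
  obtain ⟨d, hd'⟩ := exists_nat_add_sub_nonneg s e l
  have hd : ∀ a ∈ s, ∀ q, 0 ≤ d + e a (τ q) - e a l := fun a ha q ↦ hd' a ha (τ q)
  set P := facePoint J l τ ε with hP
  set g := facePolynomial s c e l τ ε d with hg
  have hpos : ∀ t : Fin m → ℝ, (∀ q, 0 < t q) → 0 < (∏ q, t q) ^ d := fun t ht ↦
    pow_pos (Finset.prod_pos fun q _ ↦ ht q) _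
  have hzero : ∀ t : Fin m → ℝ, (∀ q, 0 < t q) →
      (MvPolynomial.eval t g = 0 ↔ laurentEval s c e (P t) = 0) := fun t ht ↦ by
    rw [hg, eval_facePolynomial hl hd ht, mul_eq_zero, or_iff_right (hpos t ht).ne']
  have hgcard : g.support.card ≤ m + (k + 1) + 1 := by
    have h1 := card_support_facePolynomial_le (J := J) (l := l) (τ := τ) (ε := ε) (c := c) (d := d)
      (s := s) (e := e) (T := (insert 0 J).image p)
      (fun a ha ↦ by
        obtain ⟨j, _, rfl⟩ := Finset.mem_image.1 ha
        exact hps j)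
      ((Finset.insert_nonempty _ _).image p)
      (by
        have key : ∀ i ∈ insert 0 J, ∀ j ∉ J, e (p i) j = e (p 0) j := fun i hi j hj ↦ by
          rcases Finset.mem_insert.1 hi with rfl | hi
          · rfl
          · exact hpe i j fun h ↦ hj (h ▸ hi)
        intro a ha b hb j hj
        obtain ⟨i, hi, rfl⟩ := Finset.mem_image.1 ha
        obtain ⟨i', hi', rfl⟩ := Finset.mem_image.1 hb
        rw [key i hi j hj, key i hi l hl, key i' hi' j hj, key i' hi' l hl])
    have h2 : J.card ≤ ((insert 0 J).image p).card := by
      rw [Finset.card_image_of_injective _ hp]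
      exact Finset.card_le_card (Finset.subset_insert _ _)
    rw [← hg] at h1
    omega
  have hgsm : ∀ t ∈ posZeroSet g, ∃ q, MvPolynomial.eval t (MvPolynomial.pderiv q g) ≠ 0 := by
    rintro t ⟨ht, ht0⟩
    by_contra! h
    have hF := (hzero t ht).1 ht0
    have h1 : ∀ i ∉ J, laurentLogDeriv s c e i (P t) = laurentLogDeriv s c e l (P t) := by
      intro i hi
      by_cases hil : i = l
      · rw [hil]
      have h2 := mul_eval_pderiv_facePolynomial (c := c) (ε := ε) hl hd ht (τ.symm ⟨i, hi, hil⟩)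
      rw [← hg, ← hP, h, mul_zero, hF, mul_zero, zero_add, Equiv.apply_symm_apply] at h2
      exact sub_eq_zero.1 ((mul_eq_zero.1 h2.symm).resolve_left (hpos t ht).ne')
    obtain ⟨i, j, hij⟩ := hsm (P t) (facePoint_pos hε0 ht) hF
    have h2 := laurentLogDeriv_eq_of_generic hε (facePoint_pos hε0 ht) (prod_facePoint hl hε0 ht)
      (fun j hj ↦ facePoint_of_mem hj) hF h1
    exact hij ((h2 i).trans (h2 j).symm)
  obtain ⟨hfin, hle⟩ := compact_components_le hm hB hgcard hgsm
  have hex : ∀ C ∈ T, ∃ t ∈ posZeroSet g, Φ (P t) ∈ C ∧ ∀ j, ε j ≤ P t j := by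
    intro C hC
    obtain ⟨u, hu, hprod, hF, hΦC, hge, hJ⟩ := hTJ C hC
    have hPu : P (fun q ↦ u (τ q)) = u := facePoint_eq_of_prod_eq_one hl hprod hJ
    exact ⟨fun q ↦ u (τ q), ⟨fun q ↦ hu _, (hzero _ fun q ↦ hu _).2 (by rwa [hPu])⟩,
      by rwa [hPu], by rwa [hPu]⟩
  choose! t htZ htC htε using hex
  let K : Set (Fin n → ℝ) → Set (Fin m → ℝ) := fun C ↦ connectedComponentIn (posZeroSet g) (t C)
  have hKZ : ∀ C, K C ⊆ posZeroSet g := fun C ↦ connectedComponentIn_subset _ _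
  have htK : ∀ C ∈ T, t C ∈ K C := fun C hC ↦ mem_connectedComponentIn (htZ C hC)
  have hKC : ∀ C ∈ T, ∀ y ∈ K C, Φ (P y) ∈ C := by
    intro C hC y hy
    have hcont : ContinuousOn (fun y ↦ Φ (P y)) (K C) :=
      hΦ.comp ((continuousOn_facePoint hε0).mono fun y hy ↦ (hKZ C hy).1)
        fun y hy ↦ facePoint_pos hε0 (hKZ C hy).1
    have h1 := (isPreconnected_connectedComponentIn.image _ hcont).subset_connectedComponentIn
      (F := X) ⟨t C, htK C hC, rfl⟩ (by
        rintro _ ⟨z, hz, rfl⟩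
        exact hΦX _ (facePoint_pos hε0 (hKZ C hz).1) ((hzero z (hKZ C hz).1).1 (hKZ C hz).2))
    rw [← eq_connectedComponentIn_of_mem_components (hT C hC) (htC C hC)] at h1
    exact h1 ⟨y, hy, rfl⟩
  have hQ := isCompact_facePoint_ge (τ := τ) hl hε0
  have hA : IsCompact ({t | (∀ q, 0 < t q) ∧ ∀ j, ε j ≤ P t j} ∩
      {t | MvPolynomial.eval t g = 0}) :=
    hQ.inter_right (isClosed_eq (MvPolynomial.continuous_eval g) continuous_const)
  have hKcomp : ∀ C ∈ T, IsCompact (K C) := by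
    intro C hC
    refine hA.isCompact_connectedComponentIn (fun y hy ↦ ⟨hy.1.1, hy.2⟩) ?_
    refine isPreconnected_connectedComponentIn.subset_of_inter_open hA.isClosed
      (isOpen_facePoint_gt (τ := τ) (l := l) (J := J) hε0) ?_
      ⟨t C, htK C hC, ⟨(htZ C hC).1, htε C hC⟩, (htZ C hC).2⟩
    ext y
    refine and_congr_right fun hy ↦ ⟨fun h ↦ ⟨h.1.1, ?_⟩, fun h ↦ ⟨⟨h.1, fun j ↦ ?_⟩, (hKZ C hy).2⟩⟩
    · exact hmax C hC (P y) (facePoint_pos hε0 h.1.1) (prod_facePoint hl hε0 h.1.1)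
        ((hzero y h.1.1).1 h.2) (hKC C hC y hy) h.1.2 fun j hj ↦ facePoint_of_mem hj
    · by_cases hj : j ∈ J
      · exact (facePoint_of_mem hj).ge
      · exact (h.2 j hj).le
  have hKmem : ∀ C ∈ (T : Set (Set (Fin n → ℝ))),
      K C ∈ {C ∈ components (posZeroSet g) | IsCompact C} :=
    fun C hC ↦ ⟨⟨t C, htZ C hC, rfl⟩, hKcomp C hC⟩
  rw [← Set.ncard_coe_finset]
  refine (Set.ncard_le_ncard_of_injOn K hKmem ?_ hfin).trans hle
  intro C hC C' hC' hCC'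
  have h1 := hKC C' hC' (t C) (hCC' ▸ htK C hC)
  rw [eq_connectedComponentIn_of_mem_components (hT C hC) (htC C hC),
    eq_connectedComponentIn_of_mem_components (hT C' hC') h1]

/-- Each of finitely many components of `X` is assigned to a face of maximal codimension that it
meets in the simplex `{u | ∏ u = 1, ε ≤ u}`; summing over faces bounds their number. -/
theorem card_components_le_sum_faces {α : Type*} {n k : ℕ} {κ : ℕ → ℕ}
    (hκ : ∀ m, 1 ≤ m → ∀ g : MvPolynomial (Fin m) ℝ, g.support.card ≤ m + (k + 1) + 1 →
      affineSpan ℝ ((fun (a : Fin m →₀ ℕ) (i : Fin m) => (a i : ℝ)) '' ↑g.support) = ⊤ →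
      (∀ x ∈ posZeroSet g, ∃ i, MvPolynomial.eval x (MvPolynomial.pderiv i g) ≠ 0) →
      {C ∈ components (posZeroSet g) | IsCompact C}.Finite ∧
        {C ∈ components (posZeroSet g) | IsCompact C}.ncard ≤ κ m)
    {s : Finset α} {c : α → ℝ} {e : α → Fin (n + 1) → ℤ} (hcard : s.card = n + k + 1)
    {p : Fin (n + 1) → α} (hp : Function.Injective p) (hps : ∀ j, p j ∈ s)
    (hpe : ∀ j i, i ≠ j → e (p j) i = e (p 0) i)
    (hsm : ∀ u : Fin (n + 1) → ℝ, (∀ j, 0 < u j) → laurentEval s c e u = 0 →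
      ∃ i j, laurentLogDeriv s c e i u ≠ laurentLogDeriv s c e j u)
    {X : Set (Fin n → ℝ)} {Φ : (Fin (n + 1) → ℝ) → Fin n → ℝ}
    (hΦ : ContinuousOn Φ {u | ∀ j, 0 < u j})
    (hΦX : ∀ u, (∀ j, 0 < u j) → laurentEval s c e u = 0 → Φ u ∈ X)
    (hΦsurj : ∀ x ∈ X, ∃ u : Fin (n + 1) → ℝ, (∀ j, 0 < u j) ∧ ∏ j, u j = 1 ∧
      laurentEval s c e u = 0 ∧ Φ u = x)
    {T : Finset (Set (Fin n → ℝ))} (hT : ∀ C ∈ T, C ∈ components X) :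
    T.card ≤ ∑ i ∈ Finset.range n, Nat.choose (n + 1) i * κ (n - i) := by
  classical
  have hex : ∀ C ∈ T, ∃ u : Fin (n + 1) → ℝ, (∀ j, 0 < u j) ∧ ∏ j, u j = 1 ∧
      laurentEval s c e u = 0 ∧ Φ u ∈ C := by
    intro C hC
    obtain ⟨x, hx, rfl⟩ := hT C hC
    obtain ⟨u, h1, h2, h3, rfl⟩ := hΦsurj x hx
    exact ⟨u, h1, h2, h3, mem_connectedComponentIn hx⟩
  choose! v hv hvprod hvF hvC using hex
  obtain ⟨δ, hδ, hδ1, hδv⟩ : ∃ δ : ℝ, 0 < δ ∧ δ ≤ 1 ∧ ∀ C ∈ T, ∀ j, δ ≤ v C j := by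
    have hne : (insert 1 ((T ×ˢ Finset.univ).image fun x ↦ v x.1 x.2)).Nonempty :=
      Finset.insert_nonempty _ _
    refine ⟨Finset.min' _ hne, ?_, Finset.min'_le _ _ (Finset.mem_insert_self _ _), fun C hC j ↦
      Finset.min'_le _ _ (Finset.mem_insert_of_mem (Finset.mem_image.2
        ⟨(C, j), Finset.mem_product.2 ⟨hC, Finset.mem_univ _⟩, rfl⟩))⟩
    refine (Finset.lt_min'_iff _ hne).2 fun y hy ↦ ?_
    rcases Finset.mem_insert.1 hy with rfl | hy
    · exact one_pos
    · obtain ⟨x, hx, rfl⟩ := Finset.mem_image.1 hy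
      exact hv _ (Finset.mem_product.1 hx).1 _
  obtain ⟨ε, hεδ, hε'⟩ := exists_small_independent (S := c '' s)
    (s.finite_toSet.image c).countable hδ (n + 1)
  have hε0 := fun j ↦ (hεδ j).1
  have hε : ∀ j, ∃ D : Derivation ℤ ℝ ℝ, (∀ a ∈ s, D (c a) = 0) ∧ D (ε j) ≠ 0 ∧
      ∀ i, i ≠ j → D (ε i) = 0 := fun j ↦ by
    obtain ⟨D, h1, h2⟩ := hε' j
    exact ⟨D, fun a ha ↦ h1 _ ⟨a, ha, rfl⟩, h2⟩
  let meets : Set (Fin n → ℝ) → Finset (Fin (n + 1)) → Prop := fun C J ↦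
    ∃ u : Fin (n + 1) → ℝ, (∀ j, 0 < u j) ∧ ∏ j, u j = 1 ∧
      laurentEval s c e u = 0 ∧ Φ u ∈ C ∧ (∀ j, ε j ≤ u j) ∧ ∀ j ∈ J, u j = ε j
  have hface : ∀ C ∈ T, ∃ J, meets C J ∧ ∀ J', meets C J' → J'.card ≤ J.card := by
    intro C hC
    have h0 : meets C ∅ := ⟨v C, hv C hC, hvprod C hC, hvF C hC, hvC C hC,
      fun j ↦ (hεδ j).2.le.trans (hδv C hC j), by simp⟩
    obtain ⟨J, hJ, hJmax⟩ := Finset.exists_max_image (Finset.univ.filter (meets C)) Finset.card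
      ⟨∅, by simpa using h0⟩
    exact ⟨J, (Finset.mem_filter.1 hJ).2, fun J' hJ' ↦ hJmax J' (by simpa using hJ')⟩
  choose! face hmeets hmax using hface
  have hlt : ∀ C ∈ T, (face C).card < n := by
    intro C hC
    obtain ⟨u, hu, hprod, hF, -, -, hJ⟩ := hmeets C hC
    by_contra! hn
    have hcompl : (face C)ᶜ.card ≤ 1 := by
      rw [Finset.card_compl, Fintype.card_fin]
      omega
    obtain ⟨l, hl⟩ : ∃ l, l ∉ face C := by
      by_contra! h
      have hu1 : ∀ j, u j < 1 := fun j ↦ by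
        rw [hJ j (h j)]
        exact (hεδ j).2.trans_le hδ1
      have h1 := Finset.prod_lt_prod (s := Finset.univ) (g := fun _ ↦ (1 : ℝ)) (fun j _ ↦ hu j)
        (fun j _ ↦ (hu1 j).le) ⟨0, Finset.mem_univ _, hu1 0⟩
      rw [hprod, Finset.prod_const_one] at h1
      exact lt_irrefl _ h1
    have h1 : ∀ i ∉ face C, laurentLogDeriv s c e i u = laurentLogDeriv s c e l u := by
      intro i hi
      rw [Finset.card_le_one.1 hcompl i (Finset.mem_compl.2 hi) l (Finset.mem_compl.2 hl)]
    obtain ⟨i, j, hij⟩ := hsm u hu hF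
    have h2 := laurentLogDeriv_eq_of_generic hε hu hprod hJ hF h1
    exact hij ((h2 i).trans (h2 j).symm)
  have hfiber : ∀ J : Finset (Fin (n + 1)),
      (T.filter fun C ↦ face C = J).card ≤ if J.card < n then κ (n - J.card) else 0 := by
    intro J
    split_ifs with hJ
    · refine card_components_le_of_face (m := n - J.card) (by omega) (hκ _ (by omega)) hcard hp hps
        hpe hsm hε0 hε hΦ hΦX (by omega) (J := J) (fun C hC ↦ hT C (Finset.mem_filter.1 hC).1) ?_ ?_
      · rintro C hC
        obtain ⟨hCT, rfl⟩ := Finset.mem_filter.1 hC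
        exact hmeets C hCT
      · rintro C hC u h1 h2 h3 h4 h5 h6 j hj
        obtain ⟨hCT, rfl⟩ := Finset.mem_filter.1 hC
        refine lt_of_le_of_ne (h5 j) fun h ↦ ?_
        have h7 := hmax C hCT (insert j (face C)) ⟨u, h1, h2, h3, h4, h5, fun i hi ↦ by
          rcases Finset.mem_insert.1 hi with rfl | hi
          · exact h.symm
          · exact h6 i hi⟩
        rw [Finset.card_insert_of_notMem hj] at h7
        omega
    · refine (Finset.card_eq_zero.2 (Finset.filter_eq_empty_iff.2 fun C hC h ↦ hJ ?_)).le
      exact h ▸ hlt C hC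
  calc T.card = ∑ J : Finset (Fin (n + 1)), (T.filter fun C ↦ face C = J).card :=
        Finset.card_eq_sum_card_fiberwise fun C _ ↦ Finset.mem_coe.2 (Finset.mem_univ _)
    _ ≤ ∑ J : Finset (Fin (n + 1)), if J.card < n then κ (n - J.card) else 0 :=
        Finset.sum_le_sum fun J _ ↦ hfiber J
    _ = ∑ i ∈ Finset.range (n + 1 + 1), (n + 1).choose i * if i < n then κ (n - i) else 0 := by
        have := Finset.sum_powerset_apply_card (f := fun i ↦ if i < n then κ (n - i) else 0)
          (x := (Finset.univ : Finset (Fin (n + 1))))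
        simpa using this
    _ = ∑ i ∈ Finset.range n, (n + 1).choose i * κ (n - i) := by
        rw [Finset.sum_range_succ, Finset.sum_range_succ]
        simp only [lt_irrefl, if_false, mul_zero, add_zero,
          not_lt_of_gt (Nat.lt_succ_self n)]
        exact Finset.sum_congr rfl fun i hi ↦ by rw [if_pos (Finset.mem_range.1 hi)]

theorem exists_exponents_det_ne_zero {n : ℕ} {s : Finset (Fin n →₀ ℕ)}
    (hs : affineSpan ℝ ((fun (a : Fin n →₀ ℕ) (i : Fin n) => (a i : ℝ)) '' ↑s) = ⊤) :
    ∃ p : Fin (n + 1) → (Fin n →₀ ℕ), Function.Injective p ∧ (∀ j, p j ∈ s) ∧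
      (Matrix.of fun j i : Fin n ↦ ((p j.succ i : ℤ) - p 0 i)).det ≠ 0 := by
  obtain ⟨t, hts, hspan, hind⟩ := exists_affineIndependent ℝ (Fin n → ℝ)
    ((fun (a : Fin n →₀ ℕ) (i : Fin n) => (a i : ℝ)) '' ↑s)
  rw [hs] at hspan
  have hfin : t.Finite := (s.finite_toSet.image _).subset hts
  have := hfin.fintype
  have hcard : Fintype.card t = n + 1 := by
    have := hind.affineSpan_eq_top_iff_card_eq_finrank_add_one.1 (by simpa using hspan)
    simpa using this
  have hex : ∀ j : Fin (n + 1), ∃ a ∈ s, (fun i ↦ (a i : ℝ)) =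
      ((Fintype.equivFinOfCardEq hcard).symm j : Fin n → ℝ) := fun j ↦
    hts ((Fintype.equivFinOfCardEq hcard).symm j).2
  choose p hps hp using hex
  have hind' : AffineIndependent ℝ fun (j : Fin (n + 1)) (i : Fin n) ↦ (p j i : ℝ) := by
    have := hind.comp_embedding (Fintype.equivFinOfCardEq hcard).symm.toEmbedding
    refine (congrArg (AffineIndependent ℝ) (funext fun j ↦ ?_)).mpr this
    exact hp j
  refine ⟨p, fun i j h ↦ hind'.injective (by simp [h]), hps, fun h0 ↦ ?_⟩
  have hlin := (affineIndependent_iff_linearIndependent_vsub ℝ _ (0 : Fin (n + 1))).1 hind'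
  have hrow := hlin.comp (fun j : Fin n ↦ ⟨j.succ, Fin.succ_ne_zero j⟩)
    fun i j h ↦ Fin.succ_injective _ (congrArg Subtype.val h)
  have hunit := (Matrix.linearIndependent_rows_iff_isUnit
    (A := (Matrix.of fun j i : Fin n ↦ ((p j.succ i : ℤ) - p 0 i)).map (Int.castRingHom ℝ))).1 (by
      have h : ((Matrix.of fun j i : Fin n ↦ ((p j.succ i : ℤ) - p 0 i)).map
          (Int.castRingHom ℝ)).row = fun j i ↦ (p j.succ i : ℝ) - p 0 i := by
        ext j i
        simp
      rw [h]
      exact hrow)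
  rw [Matrix.isUnit_iff_isUnit_det, ← RingHom.mapMatrix_apply, ← RingHom.map_det, h0] at hunit
  simp at hunit

theorem MvPolynomial.mul_eval_pderiv {n : ℕ} (f : MvPolynomial (Fin n) ℝ) (r : Fin n)
    (x : Fin n → ℝ) : x r * eval x (pderiv r f) =
      ∑ a ∈ f.support, f.coeff a * a r * ∏ i, x i ^ a i := by
  have h : x r * eval x (pderiv r f) = eval x (X r * pderiv r f) := by rw [map_mul, eval_X]
  rw [h]
  conv_lhs => rw [← f.support_sum_monomial_coeff]
  rw [map_sum, Finset.mul_sum, map_sum]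
  refine Finset.sum_congr rfl fun a _ ↦ ?_
  rw [X_mul_pderiv_monomial, map_nsmul, nsmul_eq_mul, eval_monomial, Finsupp.prod_fintype _ _ fun i ↦ pow_zero _]
  ring

/-- The map between positive orthants given by the Laurent monomials with exponents `N`. -/
noncomputable def monomialMap {m n : ℕ} (N : Fin n → Fin m → ℤ) (u : Fin m → ℝ) : Fin n → ℝ :=
  fun r ↦ ∏ j, u j ^ N r j

theorem monomialMap_pos {m n : ℕ} (N : Fin n → Fin m → ℤ) {u : Fin m → ℝ} (hu : ∀ j, 0 < u j)
    (r : Fin n) : 0 < monomialMap N u r :=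
  Finset.prod_pos fun j _ ↦ zpow_pos (hu j) _

theorem continuousOn_monomialMap {m n : ℕ} (N : Fin n → Fin m → ℤ) :
    ContinuousOn (monomialMap N) {u | ∀ j, 0 < u j} :=
  continuousOn_pi.2 fun _ ↦ continuousOn_finsetProd _ fun j _ ↦
    (continuous_apply j).continuousOn.zpow₀ _ fun _ hu ↦ Or.inl (hu j).ne'

theorem prod_monomialMap_pow {m n : ℕ} (N : Fin n → Fin m → ℤ) {u : Fin m → ℝ}
    (hu : ∀ j, 0 < u j) (a : Fin n →₀ ℕ) :
    ∏ r, monomialMap N u r ^ a r = ∏ j, u j ^ ∑ r, a r * N r j := by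
  have h : ∀ j, u j ^ ∑ r, a r * N r j = ∏ r, (u j ^ N r j) ^ a r := fun j ↦ by
    have : ∀ S : Finset (Fin n), u j ^ ∑ r ∈ S, a r * N r j = ∏ r ∈ S, (u j ^ N r j) ^ a r := by
      intro S
      induction S using Finset.induction_on with
      | empty => simp
      | insert r S hr ih =>
        rw [Finset.sum_insert hr, Finset.prod_insert hr, zpow_add₀ (hu j).ne', ih, mul_comm (a r : ℤ),
          zpow_mul, zpow_natCast]
    exact this _
  simp only [h, monomialMap, ← Finset.prod_pow]
  exact Finset.prod_comm

theorem laurentEval_eq_eval_monomialMap {m n : ℕ} (f : MvPolynomial (Fin n) ℝ)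
    (N : Fin n → Fin m → ℤ) {u : Fin m → ℝ} (hu : ∀ j, 0 < u j) :
    laurentEval f.support f.coeff (fun a j ↦ ∑ r, a r * N r j) u =
      MvPolynomial.eval (monomialMap N u) f := by
  rw [MvPolynomial.eval_eq', laurentEval]
  simp only [prod_monomialMap_pow N hu]

theorem laurentLogDeriv_eq_eval_monomialMap {m n : ℕ} (f : MvPolynomial (Fin n) ℝ)
    (N : Fin n → Fin m → ℤ) {u : Fin m → ℝ} (hu : ∀ j, 0 < u j) (j : Fin m) :
    laurentLogDeriv f.support f.coeff (fun a j ↦ ∑ r, a r * N r j) j u =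
      ∑ r, monomialMap N u r * MvPolynomial.eval (monomialMap N u) (MvPolynomial.pderiv r f) *
        N r j := by
  simp only [MvPolynomial.mul_eval_pderiv, prod_monomialMap_pow N hu, laurentLogDeriv, laurentEval,
    Finset.sum_mul]
  rw [Finset.sum_comm]
  refine Finset.sum_congr rfl fun a _ ↦ ?_
  push_cast
  rw [Finset.mul_sum, Finset.sum_mul]
  exact Finset.sum_congr rfl fun r _ ↦ by ring

theorem sum_cast_mul_eq_of_mul_eq_smul_one {n : ℕ} {A B : Matrix (Fin n) (Fin n) ℤ} {d : ℤ}
    (hAB : A * B = d • 1) (r r' : Fin n) :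
    ∑ i, (A r i : ℝ) * B i r' = d * if r = r' then 1 else 0 := by
  have h := congrFun (congrFun hAB r) r'
  rw [Matrix.mul_apply, Matrix.smul_apply, Matrix.one_apply] at h
  simpa using congrArg (Int.cast : ℤ → ℝ) h

theorem exists_monomialMap_eq {n : ℕ} {A B : Matrix (Fin n) (Fin n) ℤ} {d : ℤ} (hd : d ≠ 0)
    (hAB : A * B = d • 1) {x : Fin n → ℝ} (hx : ∀ r, 0 < x r) :
    ∃ u : Fin (n + 1) → ℝ, (∀ j, 0 < u j) ∧ ∏ j, u j = 1 ∧
      monomialMap (fun r ↦ Fin.cons 0 (A r)) u = x := by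
  have hd' : (d : ℝ) ≠ 0 := by exact_mod_cast hd
  let w : Fin n → ℝ := fun i ↦ (∑ r, B i r * Real.log (x r)) / d
  refine ⟨Fin.cons (Real.exp (-∑ i, w i)) fun i ↦ Real.exp (w i), ?_, ?_, ?_⟩
  · refine Fin.cases ?_ fun i ↦ ?_ <;> simp [Real.exp_pos]
  · rw [Fin.prod_univ_succ]
    simp [← Real.exp_sum, ← Real.exp_add]
  · ext r
    have h : ∑ i, w i * A r i = Real.log (x r) := by
      have h1 := sum_cast_mul_eq_of_mul_eq_smul_one hAB r
      calc ∑ i, w i * A r i = (∑ r', (∑ i, (A r i : ℝ) * B i r') * Real.log (x r')) / d := by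
            simp only [w, Finset.sum_div, Finset.sum_mul]
            rw [Finset.sum_comm]
            exact Finset.sum_congr rfl fun _ _ ↦ Finset.sum_congr rfl fun _ _ ↦ by ring
        _ = Real.log (x r) := by
            simp only [h1, mul_assoc, ← Finset.mul_sum]
            simp [mul_div_cancel_left₀ _ hd']
    rw [monomialMap, Fin.prod_univ_succ]
    simp only [Fin.cons_zero, Fin.cons_succ, zpow_zero, one_mul]
    simp only [← Real.exp_mul, ← Real.rpow_intCast, ← Real.exp_sum, h, Real.exp_log (hx r)]

/-- Suppose `κ` bounds the number of compact connected components of any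
smooth hypersurface in the positive orthant of `ℝ^m` defined by a polynomial with at most
`m + j + 1` monomials whose exponent vectors affinely span `ℝ^m`.  Then any smooth
hypersurface in the positive orthant of `ℝ^n` defined by a polynomial with exactly
`n + k + 1` monomials whose exponent vectors affinely span `ℝ^n` has at most
`∑_{i=0}^{n-1} C(n+1, i) · κ(n−i, k+1)` connected components. -/
theorem component_count_lemma (n k : ℕ) (hn : 1 ≤ n) (κ : ℕ × ℕ → ℕ)
    (hκ : ∀ m j : ℕ, 1 ≤ m → ∀ g : MvPolynomial (Fin m) ℝ,
      g.support.card ≤ m + j + 1 →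
      affineSpan ℝ ((fun (a : Fin m →₀ ℕ) (i : Fin m) => (a i : ℝ)) '' ↑g.support) = ⊤ →
      (∀ x ∈ posZeroSet g, ∃ i, MvPolynomial.eval x (MvPolynomial.pderiv i g) ≠ 0) →
      {C ∈ components (posZeroSet g) | IsCompact C}.Finite ∧
        {C ∈ components (posZeroSet g) | IsCompact C}.ncard ≤ κ (m, j))
    (f : MvPolynomial (Fin n) ℝ)
    (hcard : f.support.card = n + k + 1)
    (hspan : affineSpan ℝ ((fun (a : Fin n →₀ ℕ) (i : Fin n) => (a i : ℝ)) '' ↑f.support) = ⊤)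
    (hsmooth : ∀ x ∈ posZeroSet f, ∃ i, MvPolynomial.eval x (MvPolynomial.pderiv i f) ≠ 0) :
    (components (posZeroSet f)).Finite ∧
    (components (posZeroSet f)).ncard ≤
      ∑ i ∈ Finset.range n, Nat.choose (n + 1) i * κ (n - i, k + 1) := by
  obtain ⟨p, hp, hps, hdet⟩ := exists_exponents_det_ne_zero hspan
  set B : Matrix (Fin n) (Fin n) ℤ := Matrix.of fun j i : Fin n ↦ ((p j.succ i : ℤ) - p 0 i)
    with hB
  set A := B.adjugate
  set d := B.det
  have hAB : A * B = d • 1 := B.adjugate_mul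
  have hBA : B * A = d • 1 := B.mul_adjugate
  let N : Fin n → Fin (n + 1) → ℤ := fun r ↦ Fin.cons 0 (A r)
  have hpe : ∀ j i : Fin (n + 1), i ≠ j → ∑ r, p j r * N r i = ∑ r, p 0 r * N r i := by
    intro j i
    refine Fin.cases (fun _ ↦ by simp [N]) (fun i ↦ ?_) i
    refine Fin.cases (fun _ ↦ rfl) (fun j hij ↦ ?_) j
    have h := congrFun (congrFun hBA j) i
    rw [Matrix.smul_apply, Matrix.one_apply_ne fun h ↦ hij (congrArg Fin.succ h.symm), smul_zero,
      Matrix.mul_apply] at h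
    simp only [hB, Matrix.of_apply, sub_mul, Finset.sum_sub_distrib] at h
    exact sub_eq_zero.1 h
  have hsm : ∀ u : Fin (n + 1) → ℝ, (∀ j, 0 < u j) →
      laurentEval f.support f.coeff (fun a j ↦ ∑ r, a r * N r j) u = 0 →
      ∃ i j, laurentLogDeriv f.support f.coeff (fun a j ↦ ∑ r, a r * N r j) i u ≠
        laurentLogDeriv f.support f.coeff (fun a j ↦ ∑ r, a r * N r j) j u := by
    intro u hu h0
    rw [laurentEval_eq_eval_monomialMap f N hu] at h0
    by_contra! h
    obtain ⟨r', hr'⟩ := hsmooth _ ⟨monomialMap_pos N hu, h0⟩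
    set y : Fin n → ℝ := fun r ↦
      monomialMap N u r * MvPolynomial.eval (monomialMap N u) (MvPolynomial.pderiv r f)
    have h1 : ∀ i : Fin n, ∑ r, y r * A r i = 0 := fun i ↦ by
      have := h i.succ 0
      rw [laurentLogDeriv_eq_eval_monomialMap f N hu,
        laurentLogDeriv_eq_eval_monomialMap f N hu] at this
      simpa [N] using this
    have h2 := fun r ↦ sum_cast_mul_eq_of_mul_eq_smul_one hAB r r'
    have h3 : y r' * d = ∑ i, (∑ r, y r * A r i) * B i r' := by
      simp only [Finset.sum_mul]
      rw [Finset.sum_comm]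
      simp only [mul_assoc, ← Finset.mul_sum, h2]
      simp
    simp only [h1, zero_mul, Finset.sum_const_zero] at h3
    exact mul_ne_zero (mul_ne_zero (monomialMap_pos N hu r').ne' hr') (by exact_mod_cast hdet) h3
  have hbound : ∀ T : Finset (Set (Fin n → ℝ)), ↑T ⊆ components (posZeroSet f) →
      T.card ≤ ∑ i ∈ Finset.range n, Nat.choose (n + 1) i * κ (n - i, k + 1) := fun T hT ↦
    card_components_le_sum_faces (κ := fun m ↦ κ (m, k + 1)) (fun m hm ↦ hκ m (k + 1) hm) hcard hp
      hps hpe hsm (continuousOn_monomialMap N) (X := posZeroSet f)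
      (fun u hu h0 ↦ ⟨monomialMap_pos N hu, by rwa [← laurentEval_eq_eval_monomialMap f N hu]⟩)
      (fun x hx ↦ by
        obtain ⟨u, hu, hprod, rfl⟩ := exists_monomialMap_eq hdet hAB hx.1
        exact ⟨u, hu, hprod, (laurentEval_eq_eval_monomialMap f N hu).trans hx.2, rfl⟩) hT
  have hfin : (components (posZeroSet f)).Finite := by
    by_contra h
    obtain ⟨T, hT, hTcard⟩ := Set.Infinite.exists_subset_card_eq h
      (∑ i ∈ Finset.range n, Nat.choose (n + 1) i * κ (n - i, k + 1) + 1)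
    have := hbound T hT
    omega
  refine ⟨hfin, ?_⟩
  rw [Set.ncard_eq_toFinset_card _ hfin]
  exact hbound _ (by simp)
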